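/- arXiv:2003.00422 — 4 statements merged into one kernel-verified Lean document; each statement's English description precedes it below -/
import Mathlib

section
/- Let 𝔤 be a finite-dimensional real Lie algebra whose Killing form is negative definite, and let 𝔱 ⊆ 𝔤 be an abelian Lie subalgebra. Let C_𝔤(𝔱) = {x ∈ 𝔤 : [t, x] = 0 for all t ∈ 𝔱} be the centralizer of 𝔱 and let 𝔣 be the linear span of {[t, x] : t ∈ 𝔱, x ∈ 𝔤}. Then 𝔤 is the internal direct sum of subspaces 𝔤 = C_𝔤(𝔱) ⊕ 𝔣. -/
/-- Let `𝔤` be a finite-dimensional real Lie algebra whose Killing form is negative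
definite, and `𝔱 ⊆ 𝔤` an abelian Lie subalgebra. Let `C` be the centralizer of `𝔱`
and `𝔣` the linear span of `{[t, x] : t ∈ 𝔱, x ∈ 𝔤}`. Then `𝔤 = C ⊕ 𝔣` as an internal
direct sum of subspaces. -/
theorem centralizer_direct_sum_bracket_span
    {L : Type*} [LieRing L] [LieAlgebra ℝ L] [FiniteDimensional ℝ L]
    (hneg : ∀ x : L, x ≠ 0 → killingForm ℝ L x x < 0)
    (t : LieSubalgebra ℝ L) (habel : ∀ a ∈ t, ∀ b ∈ t, ⁅a, b⁆ = 0)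
    (C f : Submodule ℝ L)
    (hC : ∀ x : L, x ∈ C ↔ ∀ a ∈ t, ⁅a, x⁆ = 0)
    (hf : f = Submodule.span ℝ {y : L | ∃ a ∈ t, ∃ x : L, y = ⁅a, x⁆}) :
    C ⊓ f = ⊥ ∧ C ⊔ f = ⊤ := by
  set B : LinearMap.BilinForm ℝ L := killingForm ℝ L
  have hrefl : B.IsRefl := fun x y h ↦ (LieModule.traceForm_comm ℝ L L y x).trans h
  have hdef : ∀ x : L, B x x = 0 → x = 0 := fun x hx ↦ by
    by_contra h
    exact (hneg x h).ne hx
  have hCf : C = B.orthogonal f := by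
    ext x
    rw [hC, LinearMap.BilinForm.mem_orthogonal_iff, hf]
    constructor
    · intro hx y hy
      induction hy using Submodule.span_induction with
      | mem y hy =>
        obtain ⟨a, ha, z, rfl⟩ := hy
        exact (LieModule.traceForm_apply_lie_apply' ℝ L L a z x).trans (by simp [hx a ha])
      | zero => simp
      | add y z _ _ hy hz => simp [hy, hz]
      | smul r y _ hy => simp [hy]
    · intro hx a ha
      have h : B ⁅a, ⁅a, x⁆⁆ x = 0 := hx _ (Submodule.subset_span ⟨a, ha, _, rfl⟩)
      have h' : B ⁅a, ⁅a, x⁆⁆ x = -B ⁅a, x⁆ ⁅a, x⁆ :=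
        LieModule.traceForm_apply_lie_apply' ℝ L L a ⁅a, x⁆ x
      exact hdef _ (neg_eq_zero.mp (h'.symm.trans h))
  have hdisj : Disjoint f (B.orthogonal f) :=
    Submodule.disjoint_def.mpr fun x hx hx' ↦ hdef x (hx' x hx)
  have hcompl : IsCompl C f :=
    hCf ▸ ((LinearMap.BilinForm.isCompl_orthogonal_iff_disjoint hrefl).mpr hdisj).symm
  exact ⟨hcompl.inf_eq_bot, hcompl.sup_eq_top⟩
end

section
/- Let 𝔤 be a finite-dimensional real Lie algebra whose Killing form is negative definite, let 𝔱 ⊆ 𝔤 be an abelian Lie subalgebra, let C_𝔤(𝔱) = {x ∈ 𝔤 : [t, x] = 0 for all t ∈ 𝔱} and let 𝔣 be the linear span of {[t, x] : t ∈ 𝔱, x ∈ 𝔤}. Let B be a nondegenerate symmetric bilinear form on 𝔤 that is 𝔱-invariant, i.e. B([t,x], y) + B(x, [t,y]) = 0 for all t ∈ 𝔱 and x, y ∈ 𝔤. Then C_𝔤(𝔱) and 𝔣 are B-orthogonal (B(c, f) = 0 for all c ∈ C_𝔤(𝔱), f ∈ 𝔣), and the restrictions of B to C_𝔤(𝔱)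 and to 𝔣 are each nondegenerate. -/
/-- If `B` is invariant under a set `s`, then the centralizer of `s` is `B`-orthogonal to the span
of the brackets `⁅a, y⁆` with `a ∈ s`. -/
lemma apply_eq_zero_of_mem_centralizer_of_mem_span
    {R L : Type*} [CommRing R] [LieRing L] [LieAlgebra R L] {s : Set L}
    {B : LinearMap.BilinForm R L}
    (hinv : ∀ a ∈ s, ∀ x y : L, B ⁅a, x⁆ y + B x ⁅a, y⁆ = 0)
    {c w : L} (hc : ∀ a ∈ s, ⁅a, c⁆ = 0)
    (hw : w ∈ Submodule.span R {y : L | ∃ a ∈ s, ∃ x : L, y = ⁅a, x⁆}) : B c w = 0 := by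
  induction hw using Submodule.span_induction with
  | mem w hw =>
    obtain ⟨a, ha, x, rfl⟩ := hw
    simpa [hc a ha] using hinv a ha c x
  | zero => simp
  | add x y _ _ hx hy => simp [hx, hy]
  | smul r x _ hx => simp [hx]

/-- In a Lie algebra of compact type, every element is a sum of an element of the span of the
brackets with a set `s` and an element of the centralizer of `s`. -/
lemma exists_span_add_centralizer
    {L : Type*} [LieRing L] [LieAlgebra ℝ L] [FiniteDimensional ℝ L]
    (hneg : ∀ x : L, x ≠ 0 → killingForm ℝ L x x < 0) (s : Set L) (y : L) :
    ∃ w ∈ Submodule.span ℝ {y : L | ∃ a ∈ s, ∃ x : L, y = ⁅a, x⁆},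
      ∃ c : L, (∀ a ∈ s, ⁅a, c⁆ = 0) ∧ w + c = y := by
  have aniso : ∀ x : L, killingForm ℝ L x x = 0 → x = 0 := fun x hx => by
    by_contra h
    exact (hneg x h).ne hx
  have hrefl : (killingForm ℝ L).IsRefl := (LieModule.traceForm_isSymm ℝ L L).isRefl
  set F := Submodule.span ℝ {y : L | ∃ a ∈ s, ∃ x : L, y = ⁅a, x⁆}
  have hcompl : IsCompl F (LinearMap.BilinForm.orthogonal (killingForm ℝ L) F) := by
    rw [LinearMap.BilinForm.isCompl_orthogonal_iff_disjoint hrefl, Submodule.disjoint_def]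
    exact fun x hx hx' => aniso x (hx' x hx)
  obtain ⟨w, hw, c, hc, rfl⟩ := Submodule.mem_sup.1
    (hcompl.sup_eq_top ▸ Submodule.mem_top : y ∈ F ⊔ LinearMap.BilinForm.orthogonal _ F)
  refine ⟨w, hw, c, fun a ha => aniso _ ?_, rfl⟩
  have h : killingForm ℝ L ⁅a, ⁅a, c⁆⁆ c = 0 :=
    hc _ (Submodule.subset_span ⟨a, ha, ⁅a, c⁆, rfl⟩)
  have h' := LieModule.traceForm_apply_lie_apply' ℝ L L a ⁅a, c⁆ c
  rw [h] at h'
  exact neg_eq_zero.1 h'.symm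

/-- Let `𝔤` be a finite-dimensional real Lie algebra whose Killing form is negative
definite, `𝔱 ⊆ 𝔤` an abelian subalgebra, `C` the centralizer of `𝔱` and `𝔣` the span of
`{[t, x] : t ∈ 𝔱, x ∈ 𝔤}`. If `B` is a nondegenerate symmetric bilinear form on `𝔤`
which is `𝔱`-invariant, then `C` and `𝔣` are `B`-orthogonal and the restrictions of `B`
to `C` and to `𝔣` are nondegenerate. -/
theorem invariant_form_orthogonal_decomposition
    {L : Type*} [LieRing L] [LieAlgebra ℝ L] [FiniteDimensional ℝ L]
    (hneg : ∀ x : L, x ≠ 0 → killingForm ℝ L x x < 0)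
    (t : LieSubalgebra ℝ L) (habel : ∀ a ∈ t, ∀ b ∈ t, ⁅a, b⁆ = 0)
    (C f : Submodule ℝ L)
    (hC : ∀ x : L, x ∈ C ↔ ∀ a ∈ t, ⁅a, x⁆ = 0)
    (hf : f = Submodule.span ℝ {y : L | ∃ a ∈ t, ∃ x : L, y = ⁅a, x⁆})
    (B : LinearMap.BilinForm ℝ L)
    (hsymm : ∀ x y : L, B x y = B y x)
    (hnondeg : ∀ x : L, (∀ y : L, B x y = 0) → x = 0)
    (hinv : ∀ a ∈ t, ∀ x y : L, B ⁅a, x⁆ y + B x ⁅a, y⁆ = 0) :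
    (∀ c ∈ C, ∀ w ∈ f, B c w = 0) ∧
      (∀ c ∈ C, (∀ c' ∈ C, B c c' = 0) → c = 0) ∧
      (∀ w ∈ f, (∀ w' ∈ f, B w w' = 0) → w = 0) := by
  have ortho : ∀ c ∈ C, ∀ w ∈ f, B c w = 0 := fun c hc w hw =>
    apply_eq_zero_of_mem_centralizer_of_mem_span hinv ((hC c).1 hc) (hf ▸ hw)
  have split : ∀ y : L, ∃ w ∈ f, ∃ c ∈ C, w + c = y := by
    intro y
    obtain ⟨w, hw, c, hc, rfl⟩ := exists_span_add_centralizer hneg (t : Set L) y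
    exact ⟨w, hf ▸ hw, c, (hC c).2 hc, rfl⟩
  refine ⟨ortho, fun c hc h => hnondeg c fun y => ?_, fun w hw h => hnondeg w fun y => ?_⟩
  · obtain ⟨w, hw, c', hc', rfl⟩ := split y
    rw [map_add, ortho c hc w hw, h c' hc', add_zero]
  · obtain ⟨w', hw', c, hc, rfl⟩ := split y
    rw [map_add, h w' hw', hsymm, ortho c hc w hw, add_zero]
end

section
/- Let 𝔤 be a finite-dimensional simple real Lie algebra whose Killing form is negative definite, let 𝔱 ⊆ 𝔤 be a nonzero abelian Lie subalgebra, and let 𝔣 be the linear span of {[t, x] : t ∈ 𝔱, x ∈ 𝔤}. Then every element x of the centralizer C_𝔤(𝔱) = {x ∈ 𝔤 : [t, x] = 0 for all t ∈ 𝔱} can be written as a finite sum x = Σᵢ₌₁^m [xᵢ, yᵢ] with all xᵢ, yᵢ ∈ 𝔣. -/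
/-- A finite-dimensional space splits along a subspace and its orthogonal, for a symmetric
negative definite form. -/
theorem exists_add_orthogonal_of_neg_definite {V : Type*} [AddCommGroup V] [Module ℝ V]
    [FiniteDimensional ℝ V] (B : LinearMap.BilinForm ℝ V) (hB : B.IsSymm)
    (hneg : ∀ x : V, x ≠ 0 → B x x < 0) (W : Submodule ℝ V) (x : V) :
    ∃ w ∈ W, ∃ z : V, (∀ u ∈ W, B u z = 0) ∧ x = w + z := by
  have hc : IsCompl W (B.orthogonal W) := by
    refine (LinearMap.BilinForm.isCompl_orthogonal_iff_disjoint hB.isRefl).2 ?_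
    rw [Submodule.disjoint_def]
    intro u hu hu'
    by_contra h
    exact (hneg u h).ne (hu' u hu)
  obtain ⟨w, hw, z, hz, rfl⟩ := Submodule.mem_sup.1 (hc.sup_eq_top ▸ Submodule.mem_top (x := x))
  exact ⟨w, hw, z, fun u hu => hz u hu, rfl⟩

/-- The span of the brackets of elements of a subspace of a real Lie algebra. -/
def bracketSpan {L : Type*} [LieRing L] [LieAlgebra ℝ L] (f : Submodule ℝ L) : Submodule ℝ L :=
  Submodule.span ℝ {y : L | ∃ u ∈ f, ∃ v ∈ f, ⁅u, v⁆ = y}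

theorem lie_mem_bracketSpan {L : Type*} [LieRing L] [LieAlgebra ℝ L] {f : Submodule ℝ L}
    {u v : L} (hu : u ∈ f) (hv : v ∈ f) : ⁅u, v⁆ ∈ bracketSpan f :=
  Submodule.subset_span ⟨u, hu, v, hv, rfl⟩

theorem lie_mem_of_mem_span {L : Type*} [LieRing L] [LieAlgebra ℝ L] {s : Set L}
    {p : Submodule ℝ L} {c : L} (h : ∀ y ∈ s, ⁅c, y⁆ ∈ p) {y : L}
    (hy : y ∈ Submodule.span ℝ s) : ⁅c, y⁆ ∈ p :=
  (Submodule.span_le (p := p.comap (LieAlgebra.ad ℝ L c : L →ₗ[ℝ] L))).2 h hy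

/-- An element normalizing `f` normalizes the span of its brackets. -/
theorem lie_mem_bracketSpan_of_normalizes {L : Type*} [LieRing L] [LieAlgebra ℝ L]
    {f : Submodule ℝ L} {c : L} (hc : ∀ y ∈ f, ⁅c, y⁆ ∈ f) {y : L} (hy : y ∈ bracketSpan f) :
    ⁅c, y⁆ ∈ bracketSpan f := by
  refine lie_mem_of_mem_span ?_ hy
  rintro _ ⟨u, hu, v, hv, rfl⟩
  rw [leibniz_lie]
  exact add_mem (lie_mem_bracketSpan (hc u hu) hv) (lie_mem_bracketSpan hu (hc v hv))

theorem exists_sum_of_mem_bracketSpan {L : Type*} [LieRing L] [LieAlgebra ℝ L]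
    {f : Submodule ℝ L} {x : L} (hx : x ∈ bracketSpan f) :
    ∃ (m : ℕ) (xs ys : Fin m → L), (∀ i, xs i ∈ f) ∧ (∀ i, ys i ∈ f) ∧
      x = ∑ i, ⁅xs i, ys i⁆ := by
  obtain ⟨n, r, g, rfl⟩ := Submodule.mem_span_set'.1 hx
  choose u hu v hv huv using fun i => (g i).2
  exact ⟨n, fun i => r i • u i, v, fun i => f.smul_mem _ (hu i), hv, by simp [huv]⟩

/-- If every element is a sum of an element of `f` and one normalizing `f`, then
`f + [f, f]` is an ideal. -/
def idealOfNormalizes {L : Type*} [LieRing L] [LieAlgebra ℝ L] (f : Submodule ℝ L)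
    (h : ∀ x : L, ∃ w ∈ f, ∃ c : L, (∀ y ∈ f, ⁅c, y⁆ ∈ f) ∧ x = w + c) : LieIdeal ℝ L where
  __ := f ⊔ bracketSpan f
  lie_mem := by
    have hf : ∀ x : L, ∀ y ∈ f, ⁅x, y⁆ ∈ f ⊔ bracketSpan f := by
      intro x y hy
      obtain ⟨w, hw, c, hc, rfl⟩ := h x
      rw [add_lie]
      exact add_mem (Submodule.mem_sup_right (lie_mem_bracketSpan hw hy))
        (Submodule.mem_sup_left (hc y hy))
    intro x y hy
    obtain ⟨y₁, hy₁, y₂, hy₂, rfl⟩ := Submodule.mem_sup.1 hy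
    rw [lie_add]
    refine add_mem (hf x y₁ hy₁) (lie_mem_of_mem_span ?_ hy₂)
    rintro _ ⟨u, hu, v, hv, rfl⟩
    obtain ⟨w, hw, c, hc, rfl⟩ := h x
    rw [add_lie]
    refine add_mem ?_ (Submodule.mem_sup_right
      (lie_mem_bracketSpan_of_normalizes hc (lie_mem_bracketSpan hu hv)))
    rw [← lie_skew]
    exact neg_mem (hf _ w hw)


/-- Let `𝔤` be a finite-dimensional simple real Lie algebra whose Killing form is
negative definite, `𝔱 ⊆ 𝔤` a nonzero abelian subalgebra, and `𝔣` the span of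
`{[t, x] : t ∈ 𝔱, x ∈ 𝔤}`. Then every element of the centralizer of `𝔱` is a finite sum
of brackets `[xᵢ, yᵢ]` with `xᵢ, yᵢ ∈ 𝔣`. -/
theorem centralizer_elements_are_sums_of_brackets
    {L : Type*} [LieRing L] [LieAlgebra ℝ L] [FiniteDimensional ℝ L]
    [LieAlgebra.IsSimple ℝ L]
    (hneg : ∀ x : L, x ≠ 0 → killingForm ℝ L x x < 0)
    (t : LieSubalgebra ℝ L) (ht : t ≠ ⊥) (habel : ∀ a ∈ t, ∀ b ∈ t, ⁅a, b⁆ = 0)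
    (f : Submodule ℝ L)
    (hf : f = Submodule.span ℝ {y : L | ∃ a ∈ t, ∃ x : L, y = ⁅a, x⁆})
    (x : L) (hx : ∀ a ∈ t, ⁅a, x⁆ = 0) :
    ∃ (m : ℕ) (xs ys : Fin m → L), (∀ i, xs i ∈ f) ∧ (∀ i, ys i ∈ f) ∧
      x = ∑ i, ⁅xs i, ys i⁆ := by
  have hsymm : (killingForm ℝ L).IsSymm := ⟨fun u v => LieModule.traceForm_comm ℝ L L u v⟩
  have hinv : ∀ u v w : L, killingForm ℝ L ⁅u, v⁆ w = killingForm ℝ L u ⁅v, w⁆ :=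
    LieModule.traceForm_apply_lie_apply ℝ L L
  have hzero : ∀ z : L, killingForm ℝ L z z = 0 → z = 0 := fun z hz => by
    by_contra h
    exact (hneg z h).ne hz
  have hsplit := exists_add_orthogonal_of_neg_definite (killingForm ℝ L) hsymm hneg
  have hmem : ∀ a ∈ t, ∀ y : L, ⁅a, y⁆ ∈ f := fun a ha y => by
    rw [hf]
    exact Submodule.subset_span ⟨a, ha, y, rfl⟩
  have hnorm : ∀ c : L, (∀ a ∈ t, ⁅a, c⁆ = 0) → ∀ y ∈ f, ⁅c, y⁆ ∈ f := by
    intro c hc y hy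
    rw [hf] at hy
    refine lie_mem_of_mem_span ?_ hy
    rintro _ ⟨a, ha, v, rfl⟩
    rw [leibniz_lie, ← lie_skew c a, hc a ha, neg_zero, zero_lie, zero_add]
    exact hmem a ha _
  have hdec : ∀ x : L, ∃ w ∈ f, ∃ c : L, (∀ y ∈ f, ⁅c, y⁆ ∈ f) ∧ x = w + c := by
    intro x
    obtain ⟨w, hw, c, hc, rfl⟩ := hsplit f x
    refine ⟨w, hw, c, hnorm c fun a ha => hzero _ ?_, rfl⟩
    rw [← hinv, ← lie_skew, map_neg, LinearMap.neg_apply, hc _ (hmem a ha _), neg_zero]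
  have htop : f ⊔ bracketSpan f = ⊤ := by
    rcases LieAlgebra.IsSimple.eq_bot_or_eq_top (R := ℝ) (idealOfNormalizes f hdec) with h | h
    · refine absurd ((LieSubalgebra.eq_bot_iff t).2 fun a ha => hzero a ?_) ht
      have had : LieAlgebra.ad ℝ L a = 0 := by
        ext y
        have hy : ⁅a, y⁆ ∈ idealOfNormalizes f hdec := Submodule.mem_sup_left (hmem a ha y)
        rw [h] at hy
        simpa using hy
      simp [killingForm_apply_apply, had]
    · exact congrArg LieSubmodule.toSubmodule h
  refine exists_sum_of_mem_bracketSpan ?_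
  obtain ⟨w, hw, z, hz, rfl⟩ := hsplit (bracketSpan f) x
  have hzt : ∀ a ∈ t, ⁅a, z⁆ = 0 := by
    intro a ha
    have haw : ⁅a, w⁆ ∈ bracketSpan f :=
      lie_mem_bracketSpan_of_normalizes (fun y _ => hmem a ha y) hw
    have hsum := hx a ha
    rw [lie_add] at hsum
    have haz : ⁅a, z⁆ ∈ bracketSpan f := by
      rw [eq_neg_of_add_eq_zero_right hsum]
      exact neg_mem haw
    apply hzero
    rw [← hinv, ← lie_skew, map_neg, LinearMap.neg_apply,
      hz _ (lie_mem_bracketSpan_of_normalizes (fun y _ => hmem a ha y) haz), neg_zero]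
  have hzf : ∀ y ∈ f, killingForm ℝ L y z = 0 := by
    intro y hy
    rw [hf] at hy
    refine (Submodule.span_le (p := LinearMap.ker ((killingForm ℝ L).flip z))).2 ?_ hy
    rintro _ ⟨a, ha, v, rfl⟩
    change killingForm ℝ L ⁅a, v⁆ z = 0
    rw [← lie_skew, map_neg, LinearMap.neg_apply, hinv, hzt a ha, map_zero, neg_zero]
  have hz0 : z = 0 := by
    obtain ⟨p, hp, q, hq, hpq⟩ := Submodule.mem_sup.1 (htop ▸ Submodule.mem_top (x := z))
    apply hzero
    nth_rewrite 1 [← hpq]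
    rw [map_add, LinearMap.add_apply, hzf p hp, hz q hq, add_zero]
  rwa [hz0, add_zero]
end

section
/- Let 𝔤 be a Lie algebra over a field, B a symmetric bilinear form on 𝔤, and 𝔥 ⊆ 𝔤 a subspace such that: (1) B(u, h) = 0 for all u ∈ 𝔤 and h ∈ 𝔥; and (2) B is 𝔥-invariant, i.e. B([h, u], v) + B(u, [h, v]) = 0 for all h ∈ 𝔥 and u, v ∈ 𝔤. Let a, y ∈ 𝔤 and x₁, …, x_m, y₁, …, y_m ∈ 𝔤 be such that for each i: [a, xᵢ] ∈ 𝔥, [a, yᵢ] ∈ 𝔥, [[a, xᵢ], y] ∈ 𝔥 and [[a, yᵢ], y] ∈ 𝔥. Then B([a, Σᵢ₌₁^m [xᵢ, yᵢ]], y) = 0. -/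
/-- If `B` is `h`-invariant and vanishes on `L × h`, then `B ⁅x, u⁆ v = 0` whenever `x` and
`⁅x, v⁆` lie in `h`. -/
lemma LinearMap.BilinForm.apply_lie_eq_zero_of_invariant
    {K L : Type*} [CommRing K] [LieRing L] [LieAlgebra K L]
    (B : LinearMap.BilinForm K L) (h : Submodule K L)
    (h1 : ∀ u : L, ∀ x ∈ h, B u x = 0)
    (h2 : ∀ x ∈ h, ∀ u v : L, B ⁅x, u⁆ v + B u ⁅x, v⁆ = 0)
    {x v : L} (hx : x ∈ h) (hxv : ⁅x, v⁆ ∈ h) (u : L) :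
    B ⁅x, u⁆ v = 0 := by
  simpa [h1 u _ hxv] using h2 x hx u v

/-- Let `𝔤` be a Lie algebra over a field, `B` a symmetric bilinear form on `𝔤`, and
`𝔥 ⊆ 𝔤` a subspace such that `B(𝔤, 𝔥) = 0` and `B` is `𝔥`-invariant. If `a`, `y` and
`xᵢ`, `yᵢ` are such that `[a, xᵢ]`, `[a, yᵢ]`, `[[a, xᵢ], y]`, `[[a, yᵢ], y]` all lie
in `𝔥`, then `B([a, Σᵢ [xᵢ, yᵢ]], y) = 0`. -/
theorem bracket_sum_form_vanishes
    {K L : Type*} [Field K] [LieRing L] [LieAlgebra K L]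
    (B : LinearMap.BilinForm K L)
    (hsymm : ∀ u v : L, B u v = B v u)
    (h : Submodule K L)
    (h1 : ∀ u : L, ∀ x ∈ h, B u x = 0)
    (h2 : ∀ x ∈ h, ∀ u v : L, B ⁅x, u⁆ v + B u ⁅x, v⁆ = 0)
    (a y : L) (m : ℕ) (xs ys : Fin m → L)
    (hx : ∀ i, ⁅a, xs i⁆ ∈ h) (hy : ∀ i, ⁅a, ys i⁆ ∈ h)
    (hxy : ∀ i, ⁅⁅a, xs i⁆, y⁆ ∈ h) (hyy : ∀ i, ⁅⁅a, ys i⁆, y⁆ ∈ h) :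
    B ⁅a, ∑ i, ⁅xs i, ys i⁆⁆ y = 0 := by
  have key {x : L} (hx : x ∈ h) (hxv : ⁅x, y⁆ ∈ h) (u : L) : B ⁅x, u⁆ y = 0 :=
    B.apply_lie_eq_zero_of_invariant h h1 h2 hx hxv u
  rw [lie_sum, map_sum, LinearMap.sum_apply]
  refine Finset.sum_eq_zero fun i _ => ?_
  rw [leibniz_lie, ← lie_skew (xs i), map_add, map_neg, LinearMap.add_apply,
    LinearMap.neg_apply, key (hx i) (hxy i), key (hy i) (hyy i), neg_zero, add_zero]
end
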